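/- arXiv:2306.16063 — 3 statements merged into one kernel-verified Lean document; each statement's English description precedes it below -/
import Mathlib

section
/- Let (E,j) be a soft inductive system of Banach spaces over a directed set N. A uniformly bounded net x_• in (E,j) is j-convergent (i.e. lies in the seminorm closure of the set of basic nets) if and only if lim_m limsup_n ‖x_n − j_{nm} x_m‖ = 0, where lim and limsup are taken along the directed set N. -/
open Filter Topology MeasureTheory

variable {N : Type*} [Preorder N] [IsDirected N (· ≤ ·)] [Nonempty N]
variable {E : N → Type*} [∀ n, NormedAddCommGroup (E n)] [∀ n, NormedSpace ℂ (E n)]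
  [∀ n, CompleteSpace (E n)]

/-- A *soft inductive system* of Banach spaces over the directed set `N`:
linear contractions `j n m : E m → E n` (for `n ≥ m`, with `j n n = id` and
`j n m = 0` when `¬ m ≤ n`), satisfying
`lim_m limsup_n ‖(j n l - j n m ∘ j m l) x‖ = 0` for all `l` and `x : E l`. -/
structure IsSoftInductiveSystem (j : ∀ n m : N, E m →L[ℂ] E n) : Prop where
  map_self : ∀ n, j n n = ContinuousLinearMap.id ℂ (E n)
  map_not_le : ∀ n m, ¬ m ≤ n → j n m = 0
  contraction : ∀ n m, m ≤ n → ∀ x : E m, ‖j n m x‖ ≤ ‖x‖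
  soft : ∀ (l : N) (x : E l),
    Tendsto (fun m => limsup (fun n => ‖j n l x - j n m (j m l x)‖) atTop)
      atTop (𝓝 0)

/-- A net `x = (x n)_{n ∈ N}` (with `x n ∈ E n`) is uniformly bounded. -/
def UniformlyBounded (x : ∀ n, E n) : Prop := ∃ C : ℝ, ∀ n, ‖x n‖ ≤ C

/-- The seminorm `|‖x‖| = limsup_n ‖x n‖` on uniformly bounded nets. -/
noncomputable def netSeminorm (x : ∀ n, E n) : ℝ := limsup (fun n => ‖x n‖) atTop

/-- The basic net `j_{• m} ξ` associated with `ξ ∈ E m`. -/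
def basicNet (j : ∀ n m : N, E m →L[ℂ] E n) (m : N) (ξ : E m) : ∀ n, E n :=
  fun n => j n m ξ

/-- A uniformly bounded net is `j`-convergent if it lies in the seminorm-closure of
the set of basic nets. -/
def JConvergent (j : ∀ n m : N, E m →L[ℂ] E n) (x : ∀ n, E n) : Prop :=
  UniformlyBounded x ∧
    ∀ ε : ℝ, 0 < ε → ∃ (m : N) (ξ : E m), netSeminorm (fun n => x n - j n m ξ) < ε

/-- A net is a null net if `lim_n ‖x n‖ = 0`. -/
def IsNullNet (x : ∀ n, E n) : Prop := Tendsto (fun n => ‖x n‖) atTop (𝓝 0)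

/-- A realization `(G, L)` of the limit space `E_∞ = C(E,j)/C₀(E,j)` of a soft inductive
system: `L` sends a `j`-convergent net to its `j`-limit; it is linear on `j`-convergent
nets, the norm of a `j`-limit is the seminorm of the net, and every element of `G`
arises as a `j`-limit. -/
structure IsLimitSpace (j : ∀ n m : N, E m →L[ℂ] E n) (G : Type*)
    [NormedAddCommGroup G] [NormedSpace ℂ G] (L : (∀ n, E n) → G) : Prop where
  map_add : ∀ x y, JConvergent j x → JConvergent j y → L (x + y) = L x + L y
  map_smul : ∀ (c : ℂ) (x), JConvergent j x → L (c • x) = c • L x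
  norm_eq : ∀ x, JConvergent j x → ‖L x‖ = netSeminorm x
  surjective : ∀ g : G, ∃ x, JConvergent j x ∧ L x = g

theorem IsSoftInductiveSystem.norm_map_le {j : ∀ n m : N, E m →L[ℂ] E n}
    (hj : IsSoftInductiveSystem j) (n m : N) (ξ : E m) : ‖j n m ξ‖ ≤ ‖ξ‖ := by
  by_cases h : m ≤ n
  · exact hj.contraction n m h ξ
  · simp [hj.map_not_le n m h]

theorem UniformlyBounded.sub {x y : ∀ n, E n} (hx : UniformlyBounded x)
    (hy : UniformlyBounded y) : UniformlyBounded (fun n => x n - y n) := by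
  obtain ⟨C, hC⟩ := hx
  obtain ⟨D, hD⟩ := hy
  exact ⟨C + D, fun n => (norm_sub_le _ _).trans (add_le_add (hC n) (hD n))⟩

theorem IsSoftInductiveSystem.uniformlyBounded_map {j : ∀ n m : N, E m →L[ℂ] E n}
    (hj : IsSoftInductiveSystem j) (m : N) (ξ : E m) :
    UniformlyBounded (fun n => j n m ξ) :=
  ⟨‖ξ‖, fun n => hj.norm_map_le n m ξ⟩

theorem UniformlyBounded.isBoundedUnder {x : ∀ n, E n} (hx : UniformlyBounded x) :
    IsBoundedUnder (· ≤ ·) atTop (fun n => ‖x n‖) := by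
  obtain ⟨C, hC⟩ := hx
  exact isBoundedUnder_of ⟨C, hC⟩

theorem UniformlyBounded.limsup_norm_nonneg {x : ∀ n, E n} (hx : UniformlyBounded x) :
    0 ≤ limsup (fun n => ‖x n‖) atTop :=
  le_limsup_of_frequently_le (Frequently.of_forall fun n => norm_nonneg (x n))
    hx.isBoundedUnder

theorem limsup_norm_le_of_eventually_le {x : ∀ n, E n} {c : ℝ}
    (h : ∀ᶠ n in atTop, ‖x n‖ ≤ c) : limsup (fun n => ‖x n‖) atTop ≤ c :=
  limsup_le_of_le (IsBoundedUnder.isCoboundedUnder_le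
    (isBoundedUnder_of ⟨0, fun n => norm_nonneg (x n)⟩)) h

/-- A uniformly bounded net in a soft inductive system is
`j`-convergent iff `lim_m limsup_n ‖x n - j n m (x m)‖ = 0`. -/
theorem jConvergent_iff_cauchy (j : ∀ n m : N, E m →L[ℂ] E n)
    (hj : IsSoftInductiveSystem j) (x : ∀ n, E n) (hx : UniformlyBounded x) :
    JConvergent j x ↔
      Tendsto (fun m => limsup (fun n => ‖x n - j n m (x m)‖) atTop) atTop (𝓝 0) := by
  constructor
  · rintro ⟨-, h⟩
    refine tendsto_order.2 ⟨fun a ha => Eventually.of_forall fun m => ha.trans_le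
      (hx.sub (hj.uniformlyBounded_map m (x m))).limsup_norm_nonneg, fun ε hε => ?_⟩
    obtain ⟨m, ξ, hξ⟩ := h (ε / 4) (by positivity)
    have hnear : ∀ᶠ n in atTop, ‖x n - j n m ξ‖ < ε / 4 :=
      eventually_lt_of_limsup_lt hξ (hx.sub (hj.uniformlyBounded_map m ξ)).isBoundedUnder
    filter_upwards [hnear, (hj.soft m ξ).eventually_lt_const (by positivity : 0 < ε / 4)]
      with k hk hsoft
    have hsoft' : ∀ᶠ n in atTop, ‖j n m ξ - j n k (j k m ξ)‖ < ε / 4 :=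
      eventually_lt_of_limsup_lt hsoft ((hj.uniformlyBounded_map m ξ).sub
        (hj.uniformlyBounded_map k (j k m ξ))).isBoundedUnder
    refine (limsup_norm_le_of_eventually_le (c := 3 * (ε / 4)) ?_).trans_lt (by linarith)
    filter_upwards [hnear, hsoft'] with n hn hns
    have hmap : ‖j n k (x k - j k m ξ)‖ < ε / 4 := (hj.norm_map_le n k _).trans_lt hk
    calc ‖x n - j n k (x k)‖
        = ‖(x n - j n m ξ) + (j n m ξ - j n k (j k m ξ)) - j n k (x k - j k m ξ)‖ := by
          rw [map_sub]; congr 1; abel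
      _ ≤ ‖x n - j n m ξ‖ + ‖j n m ξ - j n k (j k m ξ)‖ + ‖j n k (x k - j k m ξ)‖ :=
          (norm_sub_le _ _).trans (add_le_add_left (norm_add_le _ _) _)
      _ ≤ 3 * (ε / 4) := by linarith
  · intro h
    refine ⟨hx, fun ε hε => ?_⟩
    obtain ⟨m, hm⟩ := (h.eventually_lt_const hε).exists
    exact ⟨m, x m, hm⟩
end

section
/- Let (E,j) be a soft inductive system of Banach spaces over a directed set N and let x_• be a j-convergent net. Then the net of real numbers (‖x_n‖)_{n∈N} converges along N, and its limit equals limsup_n ‖x_n‖. -/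
open Filter Topology MeasureTheory

variable {N : Type*} [Preorder N] [IsDirected N (· ≤ ·)] [Nonempty N]
variable {E : N → Type*} [∀ n, NormedAddCommGroup (E n)] [∀ n, NormedSpace ℂ (E n)]
  [∀ n, CompleteSpace (E n)]

namespace IsSoftInductiveSystem

/-- The connecting maps are contractions for every pair of indices. -/
theorem norm_map_le_s1 {j : ∀ n m : N, E m →L[ℂ] E n} (hj : IsSoftInductiveSystem j)
    (n m : N) (ξ : E m) : ‖j n m ξ‖ ≤ ‖ξ‖ := by
  by_cases h : m ≤ n
  · exact hj.contraction n m h ξ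
  · simp [hj.map_not_le n m h]

/-- Along a basic net, the defect of transitivity at `m` is eventually small. -/
theorem eventually_eventually_norm_sub_lt {j : ∀ n m : N, E m →L[ℂ] E n}
    (hj : IsSoftInductiveSystem j) (l : N) (ξ : E l) {ε : ℝ} (hε : 0 < ε) :
    ∀ᶠ m in atTop, ∀ᶠ n in atTop, ‖j n l ξ - j n m (j m l ξ)‖ < ε := by
  filter_upwards [(hj.soft l ξ).eventually_lt_const hε] with m hm
  refine eventually_lt_of_limsup_lt hm (isBoundedUnder_of ⟨‖ξ‖ + ‖ξ‖, fun n => ?_⟩)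
  exact (norm_sub_le _ _).trans (add_le_add (hj.norm_map_le_s1 n l ξ)
    ((hj.norm_map_le_s1 n m _).trans (hj.norm_map_le_s1 m l ξ)))

end IsSoftInductiveSystem

/-- A `j`-convergent net is eventually close to some basic net. -/
theorem JConvergent.exists_eventually_norm_sub_lt {j : ∀ n m : N, E m →L[ℂ] E n}
    (hj : IsSoftInductiveSystem j) {x : ∀ n, E n} (hx : JConvergent j x)
    {ε : ℝ} (hε : 0 < ε) :
    ∃ (l : N) (ξ : E l), ∀ᶠ n in atTop, ‖x n - j n l ξ‖ < ε := by
  obtain ⟨⟨C, hC⟩, happrox⟩ := hx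
  obtain ⟨l, ξ, hl⟩ := happrox ε hε
  refine ⟨l, ξ, eventually_lt_of_limsup_lt hl (isBoundedUnder_of ⟨C + ‖ξ‖, fun n => ?_⟩)⟩
  exact (norm_sub_le _ _).trans (add_le_add (hC n) (hj.norm_map_le_s1 n l ξ))

/-- If a net is `j`-convergent, then the net of norms `(‖x n‖)`
converges along `N`, with limit `limsup_n ‖x n‖`. -/
theorem norm_tendsto_of_jConvergent (j : ∀ n m : N, E m →L[ℂ] E n)
    (hj : IsSoftInductiveSystem j) (x : ∀ n, E n) (hx : JConvergent j x) :
    Tendsto (fun n => ‖x n‖) atTop (𝓝 (limsup (fun n => ‖x n‖) atTop)) := by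
  obtain ⟨C, hC⟩ := hx.1
  have hbdd : IsBoundedUnder (· ≤ ·) atTop (fun n => ‖x n‖) := isBoundedUnder_of ⟨C, hC⟩
  have hcobdd : IsCoboundedUnder (· ≤ ·) atTop (fun n => ‖x n‖) :=
    (isBoundedUnder_of ⟨0, fun n => norm_nonneg (x n)⟩ :
      IsBoundedUnder (· ≥ ·) atTop (fun n => ‖x n‖)).isCoboundedUnder_le
  refine tendsto_order.2 ⟨fun a ha => ?_, fun a ha => eventually_lt_of_limsup_lt ha hbdd⟩
  obtain ⟨ε, hε, hεa⟩ : ∃ ε : ℝ, 0 < ε ∧ a + 3 * ε < limsup (fun n => ‖x n‖) atTop :=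
    ⟨(limsup (fun n => ‖x n‖) atTop - a) / 4, by linarith, by linarith⟩
  obtain ⟨l, ξ, hl⟩ := hx.exists_eventually_norm_sub_lt hj hε
  filter_upwards [hl, hj.eventually_eventually_norm_sub_lt l ξ hε] with m hxm hm
  have hle : limsup (fun n => ‖x n‖) atTop ≤ ‖x m‖ + 3 * ε := by
    refine limsup_le_of_le hcobdd ?_
    filter_upwards [hl, hm] with n hxn hn
    have hn_split : ‖x n‖ ≤
        ‖x n - j n l ξ‖ + ‖j n l ξ - j n m (j m l ξ)‖ + ‖j n m (j m l ξ)‖ := by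
      simpa using norm_add₃_le (a := x n - j n l ξ)
        (b := j n l ξ - j n m (j m l ξ)) (c := j n m (j m l ξ))
    have hm_le : ‖j m l ξ‖ ≤ ‖x m‖ + ‖x m - j m l ξ‖ := norm_le_norm_add_norm_sub _ _
    linarith [hj.norm_map_le_s1 n m (j m l ξ)]
  linarith
end

section
/- Let (E,j) be a soft inductive system of Banach spaces over a directed set N whose connecting maps are asymptotically isometric, i.e. lim_m limsup_n λ_{nm} = 1 where λ_{nm} = inf { ‖j_{nm} x_m‖ : x_m ∈ E_m, ‖x_m‖ = 1 }. Then a uniformly bounded net x_• is j-convergent if and only if the net (j_{∞n} x_n)_{n∈N} converges in the limit space E_∞; in that case j-lim_n x_n = lim_n j_{∞n} x_n. -/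
open Filter Topology MeasureTheory

variable {N : Type*} [Preorder N] [IsDirected N (· ≤ ·)] [Nonempty N]
variable {E : N → Type*} [∀ n, NormedAddCommGroup (E n)] [∀ n, NormedSpace ℂ (E n)]
  [∀ n, CompleteSpace (E n)]

theorem eventually_lt_of_limsup_norm_lt {F : N → Type*} [∀ n, NormedAddCommGroup (F n)]
    {y : ∀ n, F n} {C ε : ℝ} (hC : ∀ n, ‖y n‖ ≤ C)
    (h : limsup (fun n => ‖y n‖) atTop < ε) : ∀ᶠ n in atTop, ‖y n‖ < ε :=
  eventually_lt_of_limsup_lt h (isBoundedUnder_of ⟨C, hC⟩)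

theorem limsup_norm_le_of_eventually_le_s8 {F : N → Type*} [∀ n, NormedAddCommGroup (F n)]
    {y : ∀ n, F n} {ε : ℝ} (h : ∀ᶠ n in atTop, ‖y n‖ ≤ ε) :
    limsup (fun n => ‖y n‖) atTop ≤ ε :=
  limsup_le_of_le (isCoboundedUnder_le_of_le atTop fun n => norm_nonneg (y n)) h

/-- Softness with the inner upper limit unfolded. -/
theorem IsSoftInductiveSystem.eventually_eventually_lt {j : ∀ n m : N, E m →L[ℂ] E n}
    (hj : IsSoftInductiveSystem j) (l : N) (ξ : E l) {ε : ℝ} (hε : 0 < ε) :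
    ∀ᶠ m in atTop, ∀ᶠ n in atTop, ‖j n l ξ - j n m (j m l ξ)‖ < ε := by
  filter_upwards [(hj.soft l ξ).eventually_lt_const hε] with m hm
  refine eventually_lt_of_limsup_norm_lt (C := ‖ξ‖ + ‖ξ‖) (fun n => ?_) hm
  exact (norm_sub_le _ _).trans (add_le_add (hj.norm_map_le n l ξ)
    ((hj.norm_map_le n m _).trans (hj.norm_map_le m l ξ)))

/-- A uniformly bounded net is `j`-convergent iff it is asymptotically close to the basic nets
generated by its own entries. -/
theorem IsSoftInductiveSystem.jConvergent_iff {j : ∀ n m : N, E m →L[ℂ] E n}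
    (hj : IsSoftInductiveSystem j) {x : ∀ n, E n} :
    JConvergent j x ↔ UniformlyBounded x ∧
      ∀ ε : ℝ, 0 < ε → ∀ᶠ m in atTop, ∀ᶠ n in atTop, ‖x n - j n m (x m)‖ < ε := by
  refine ⟨fun ⟨hb, h⟩ => ⟨hb, fun ε hε => ?_⟩, fun ⟨hb, h⟩ => ⟨hb, fun ε hε => ?_⟩⟩
  · obtain ⟨l, ξ, hl⟩ := h (ε / 3) (by positivity)
    obtain ⟨C, hC⟩ := hb
    have hxl : ∀ᶠ n in atTop, ‖x n - j n l ξ‖ < ε / 3 :=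
      eventually_lt_of_limsup_norm_lt (C := C + ‖ξ‖) (fun n => (norm_sub_le _ _).trans
        (add_le_add (hC n) (hj.norm_map_le n l ξ))) hl
    filter_upwards [hxl, hj.eventually_eventually_lt l ξ (ε := ε / 3) (by positivity)]
      with m hm hsoft
    filter_upwards [hxl, hsoft] with n hn hnm
    have hsplit : x n - j n m (x m) = (x n - j n l ξ) + (j n l ξ - j n m (j m l ξ))
        - j n m (x m - j m l ξ) := by
      rw [_root_.map_sub]; abel
    rw [hsplit]
    linarith [norm_sub_le ((x n - j n l ξ) + (j n l ξ - j n m (j m l ξ)))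
        (j n m (x m - j m l ξ)), norm_add_le (x n - j n l ξ) (j n l ξ - j n m (j m l ξ)),
      hj.norm_map_le n m (x m - j m l ξ)]
  · obtain ⟨m, hm⟩ := (h (ε / 2) (by positivity)).exists
    refine ⟨m, x m, lt_of_le_of_lt ?_ (half_lt_self hε)⟩
    exact limsup_norm_le_of_eventually_le_s8 (hm.mono fun n hn => hn.le)

theorem IsSoftInductiveSystem.jConvergent_basicNet {j : ∀ n m : N, E m →L[ℂ] E n}
    (hj : IsSoftInductiveSystem j) (m : N) (ξ : E m) : JConvergent j (basicNet j m ξ) :=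
  hj.jConvergent_iff.2 ⟨⟨‖ξ‖, fun n => hj.norm_map_le n m ξ⟩,
    fun _ hε => hj.eventually_eventually_lt m ξ hε⟩

theorem JConvergent.smul {j : ∀ n m : N, E m →L[ℂ] E n} {x : ∀ n, E n}
    (hx : JConvergent j x) (hj : IsSoftInductiveSystem j) (c : ℂ) : JConvergent j (c • x) := by
  obtain ⟨⟨C, hC⟩, h⟩ := hj.jConvergent_iff.1 hx
  refine hj.jConvergent_iff.2 ⟨⟨‖c‖ * C, fun n => ?_⟩, fun ε hε => ?_⟩
  · rw [Pi.smul_apply, norm_smul]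
    exact mul_le_mul_of_nonneg_left (hC n) (norm_nonneg c)
  · filter_upwards [h (ε / (‖c‖ + 1)) (by positivity)] with m hm
    filter_upwards [hm] with n hn
    rw [Pi.smul_apply, Pi.smul_apply, _root_.map_smul, ← smul_sub, norm_smul]
    rw [lt_div_iff₀ (by positivity)] at hn
    nlinarith [norm_nonneg (x n - j n m (x m))]

theorem JConvergent.add {j : ∀ n m : N, E m →L[ℂ] E n} {x y : ∀ n, E n}
    (hx : JConvergent j x) (hy : JConvergent j y) (hj : IsSoftInductiveSystem j) :
    JConvergent j (x + y) := by
  obtain ⟨⟨C, hC⟩, h⟩ := hj.jConvergent_iff.1 hx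
  obtain ⟨⟨D, hD⟩, k⟩ := hj.jConvergent_iff.1 hy
  refine hj.jConvergent_iff.2 ⟨⟨C + D, fun n => ?_⟩, fun ε hε => ?_⟩
  · exact (norm_add_le _ _).trans (add_le_add (hC n) (hD n))
  · filter_upwards [h (ε / 2) (by positivity), k (ε / 2) (by positivity)] with m hm km
    filter_upwards [hm, km] with n hn kn
    rw [Pi.add_apply, Pi.add_apply, _root_.map_add, add_sub_add_comm]
    linarith [norm_add_le (x n - j n m (x m)) (y n - j n m (y m))]

theorem JConvergent.sub {j : ∀ n m : N, E m →L[ℂ] E n} {x y : ∀ n, E n}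
    (hx : JConvergent j x) (hy : JConvergent j y) (hj : IsSoftInductiveSystem j) :
    JConvergent j (x - y) := by
  have hxy : x - y = x + (-1 : ℂ) • y := by rw [neg_one_smul, sub_eq_add_neg]
  exact hxy ▸ hx.add (hy.smul hj _) hj

/-- `j`-convergence is stable under null perturbations. -/
theorem JConvergent.of_isNullNet_sub {j : ∀ n m : N, E m →L[ℂ] E n} {x y : ∀ n, E n}
    (hy : JConvergent j y) (hj : IsSoftInductiveSystem j) (hx : UniformlyBounded x)
    (hxy : IsNullNet (x - y)) : JConvergent j x := by
  refine hj.jConvergent_iff.2 ⟨hx, fun ε hε => ?_⟩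
  have hnull : ∀ᶠ n in atTop, ‖x n - y n‖ < ε / 3 :=
    hxy.eventually_lt_const (show (0 : ℝ) < ε / 3 by positivity)
  filter_upwards [hnull, (hj.jConvergent_iff.1 hy).2 (ε / 3) (by positivity)] with m hm hym
  filter_upwards [hnull, hym] with n hn hyn
  have hsplit : x n - j n m (x m) = (x n - y n) + (y n - j n m (y m)) - j n m (x m - y m) := by
    rw [_root_.map_sub]; abel
  rw [hsplit]
  linarith [norm_sub_le ((x n - y n) + (y n - j n m (y m))) (j n m (x m - y m)),
    norm_add_le (x n - y n) (y n - j n m (y m)), hj.norm_map_le n m (x m - y m)]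

theorem IsLimitSpace.map_sub {j : ∀ n m : N, E m →L[ℂ] E n} {G : Type*}
    [NormedAddCommGroup G] [NormedSpace ℂ G] {L : (∀ n, E n) → G} (hL : IsLimitSpace j G L)
    (hj : IsSoftInductiveSystem j) {x y : ∀ n, E n} (hx : JConvergent j x)
    (hy : JConvergent j y) : L (x - y) = L x - L y := by
  have hxy : x - y = x + (-1 : ℂ) • y := by rw [neg_one_smul, sub_eq_add_neg]
  rw [hxy, hL.map_add _ _ hx (hy.smul hj _), hL.map_smul _ _ hy, neg_one_smul, sub_eq_add_neg]

theorem IsLimitSpace.tendsto_basicNet {j : ∀ n m : N, E m →L[ℂ] E n} {G : Type*}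
    [NormedAddCommGroup G] [NormedSpace ℂ G] {L : (∀ n, E n) → G} (hL : IsLimitSpace j G L)
    (hj : IsSoftInductiveSystem j) {x : ∀ n, E n} (hx : JConvergent j x) :
    Tendsto (fun n => L (basicNet j n (x n))) atTop (𝓝 (L x)) := by
  rw [Metric.tendsto_nhds]
  intro ε hε
  filter_upwards [(hj.jConvergent_iff.1 hx).2 (ε / 2) (by positivity)] with m hm
  have hb := hj.jConvergent_basicNet m (x m)
  rw [dist_comm, dist_eq_norm, ← hL.map_sub hj hx hb, hL.norm_eq _ (hx.sub hb hj)]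
  exact (limsup_norm_le_of_eventually_le_s8 (hm.mono fun n hn => hn.le)).trans_lt (half_lt_self hε)

theorem sInf_norm_map_mul_le {V W : Type*} [NormedAddCommGroup V] [NormedSpace ℂ V]
    [NormedAddCommGroup W] [NormedSpace ℂ W] (f : V →L[ℂ] W) (v : V) :
    sInf {r : ℝ | ∃ ξ : V, ‖ξ‖ = 1 ∧ r = ‖f ξ‖} * ‖v‖ ≤ ‖f v‖ := by
  rcases eq_or_ne v 0 with rfl | hv
  · simp
  have hpos : 0 < ‖v‖ := norm_pos_iff.2 hv
  have hbdd : BddBelow {r : ℝ | ∃ ξ : V, ‖ξ‖ = 1 ∧ r = ‖f ξ‖} :=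
    ⟨0, by rintro _ ⟨ξ, -, rfl⟩; exact norm_nonneg _⟩
  have hle := csInf_le hbdd ⟨((‖v‖⁻¹ : ℝ) : ℂ) • v, by simp [norm_smul, hpos.ne'], rfl⟩
  rw [_root_.map_smul, norm_smul, Complex.norm_real, norm_inv, norm_norm] at hle
  rwa [← le_div_iff₀ hpos, div_eq_inv_mul]

/-- Once the upper limit of the lower bounds `λ_{n m}` exceeds `c`, the basic nets starting at `m`
have seminorm at least `c` times the norm of their initial vector. -/
theorem IsSoftInductiveSystem.mul_norm_le_netSeminorm {j : ∀ n m : N, E m →L[ℂ] E n}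
    (hj : IsSoftInductiveSystem j) {m : N} {c : ℝ}
    (hc : c < limsup (fun n => sInf {r : ℝ | ∃ ξ : E m, ‖ξ‖ = 1 ∧ r = ‖j n m ξ‖}) atTop)
    (ξ : E m) : c * ‖ξ‖ ≤ netSeminorm (basicNet j m ξ) := by
  have hfreq := frequently_lt_of_lt_limsup (isCoboundedUnder_le_of_le atTop (x := 0) fun n =>
    Real.sInf_nonneg (by rintro _ ⟨ξ, -, rfl⟩; exact norm_nonneg _)) hc
  refine le_limsup_of_frequently_le (hfreq.mono fun n hn => ?_)
    (isBoundedUnder_of ⟨‖ξ‖, fun n => hj.norm_map_le n m ξ⟩)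
  exact (mul_le_mul_of_nonneg_right hn.le (norm_nonneg ξ)).trans (sInf_norm_map_mul_le (j n m) ξ)

/-- If the connecting maps are asymptotically isometric, i.e.
`lim_m limsup_n λ_{n m} = 1` with `λ_{n m} = inf { ‖j n m ξ‖ : ‖ξ‖ = 1 }`, then a
uniformly bounded net `x` is `j`-convergent iff the net `(j_{∞ n} (x n))_n` converges
in the limit space, and in that case the limit is `j-lim x`. -/
theorem jConvergent_iff_embeddings_converge (j : ∀ n m : N, E m →L[ℂ] E n)
    (hj : IsSoftInductiveSystem j)
    (hiso : Tendsto (fun m => limsup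
        (fun n => sInf {r : ℝ | ∃ ξ : E m, ‖ξ‖ = 1 ∧ r = ‖j n m ξ‖}) atTop)
      atTop (𝓝 1))
    {G : Type*} [NormedAddCommGroup G] [NormedSpace ℂ G] [CompleteSpace G]
    (L : (∀ n, E n) → G) (hL : IsLimitSpace j G L)
    (x : ∀ n, E n) (hx : UniformlyBounded x) :
    (JConvergent j x ↔
      ∃ g : G, Tendsto (fun n => L (basicNet j n (x n))) atTop (𝓝 g)) ∧
    (JConvergent j x →
      Tendsto (fun n => L (basicNet j n (x n))) atTop (𝓝 (L x))) := by
  refine ⟨⟨fun h => ⟨L x, hL.tendsto_basicNet hj h⟩, ?_⟩, hL.tendsto_basicNet hj⟩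
  rintro ⟨g, hg⟩
  obtain ⟨y, hy, rfl⟩ := hL.surjective g
  refine hy.of_isNullNet_sub hj hx ?_
  have hdiff : Tendsto (fun n => 2 * ‖L (basicNet j n (x n)) - L (basicNet j n (y n))‖)
      atTop (𝓝 0) := by
    simpa using ((hg.sub (hL.tendsto_basicNet hj hy)).norm).const_mul 2
  refine squeeze_zero' (Eventually.of_forall fun n => norm_nonneg _) ?_ hdiff
  filter_upwards [hiso.eventually_const_lt (show (1 / 2 : ℝ) < 1 by norm_num)] with n hn
  have hsub : basicNet j n (x n) - basicNet j n (y n) = basicNet j n (x n - y n) :=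
    funext fun k => (_root_.map_sub (j k n) (x n) (y n)).symm
  rw [← hL.map_sub hj (hj.jConvergent_basicNet n _) (hj.jConvergent_basicNet n _), hsub,
    hL.norm_eq _ (hj.jConvergent_basicNet n _), Pi.sub_apply]
  linarith [hj.mul_norm_le_netSeminorm hn (x n - y n)]
end
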